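/- In the stochastic SQP setting with adaptive (Adagrad-Norm-type) stepsizes described in the context, for every K ∈ ℕ with K ≥ 1: 𝔼[q_{K−1}] ≤ q₋₁ + (2/(ν·σ))·( τ_min·(f(x₀) − f_low) + ‖c(x₀)‖₁ + κ₅·log(1 + κ_c·K/q₋₁²) + κ₆·log(1 + ζ⁻¹(κ_Hκ_u² + ζ⁻¹M)·K/b₋₁²) ). -/

import Mathlib

open Matrix MeasureTheory RealInnerProductSpace

/-- The ℓ¹-norm of a vector in `ℝ^m`. -/
noncomputable def l1Norm {k : ℕ} (v : EuclideanSpace ℝ (Fin k)) : ℝ := ∑ i, |v i|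

/-- The Jacobian matrix of `c` at `z`, whose rows are the gradients of the components. -/
noncomputable def Jmat {m n : ℕ}
    (gradc : Fin m → EuclideanSpace ℝ (Fin n) → EuclideanSpace ℝ (Fin n))
    (z : EuclideanSpace ℝ (Fin n)) : Matrix (Fin m) (Fin n) ℝ :=
  Matrix.of fun i j => gradc i z j

/-- The previous value of an accumulator sequence: `prevSeq init b k = b (k-1)`,
with value `init` at `k = 0` (i.e. the "index `-1`" initial value). -/
noncomputable def prevSeq {Ω : Type*} (init : ℝ) (b : ℕ → Ω → ℝ) : ℕ → Ω → ℝ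
  | 0 => fun _ => init
  | k + 1 => b k

lemma l1Norm_nonneg {k : ℕ} (v : EuclideanSpace ℝ (Fin k)) : 0 ≤ l1Norm v :=
  Finset.sum_nonneg fun _ _ => abs_nonneg _

lemma norm_le_l1Norm {k : ℕ} (v : EuclideanSpace ℝ (Fin k)) : ‖v‖ ≤ l1Norm v := by
  refine abs_le_of_sq_le_sq' ?_ (l1Norm_nonneg v) |>.2
  rw [EuclideanSpace.real_norm_sq_eq]
  simpa [l1Norm] using
    Finset.sum_sq_le_sq_sum_of_nonneg (s := Finset.univ) (f := fun i => |v i|)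
      (fun i _ => abs_nonneg _)

lemma inner_toEuclideanLin_transpose {m n : ℕ} (A : Matrix (Fin m) (Fin n) ℝ)
    (w : EuclideanSpace ℝ (Fin n)) (z : EuclideanSpace ℝ (Fin m)) :
    ⟪w, Matrix.toEuclideanLin Aᵀ z⟫ = ⟪Matrix.toEuclideanLin A w, z⟫ := by
  rw [← Matrix.conjTranspose_eq_transpose_of_trivial,
    Matrix.toEuclideanLin_conjTranspose_eq_adjoint, LinearMap.adjoint_inner_right]

lemma toEuclideanLin_Jmat_apply {m n : ℕ}
    (gradc : Fin m → EuclideanSpace ℝ (Fin n) → EuclideanSpace ℝ (Fin n))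
    (z w : EuclideanSpace ℝ (Fin n)) (i : Fin m) :
    Matrix.toEuclideanLin (Jmat gradc z) w i = ⟪gradc i z, w⟫ := by
  simp [Matrix.toLpLin_apply, Jmat, Matrix.mulVec, dotProduct, PiLp.inner_apply, mul_comm]

/-- First-order Taylor bound for a function with Lipschitz gradient. -/
lemma abs_sub_sub_inner_le_of_lipschitz_gradient {E : Type*} [NormedAddCommGroup E]
    [InnerProductSpace ℝ E] [CompleteSpace E] {h : E → ℝ} {gradh : E → E} {γ : ℝ}
    (hh : ∀ z, HasGradientAt h (gradh z) z)
    (hLip : ∀ z z', ‖gradh z - gradh z'‖ ≤ γ * ‖z - z'‖) (z w : E) :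
    |h (z + w) - h z - ⟪gradh z, w⟫| ≤ γ / 2 * ‖w‖ ^ 2 := by
  have hderiv : ∀ t : ℝ, HasDerivAt (fun t : ℝ => h (z + t • w) - h z - t * ⟪gradh z, w⟫)
      (⟪gradh (z + t • w), w⟫ - ⟪gradh z, w⟫) t := by
    intro t
    have hline : HasDerivAt (fun t : ℝ => z + t • w) w t := by
      simpa using ((hasDerivAt_id t).smul_const w).const_add z
    have hcomp := (hh (z + t • w)).hasFDerivAt.comp_hasDerivAt t hline
    have hlin := (hasDerivAt_id t).mul_const ⟪gradh z, w⟫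
    exact ((hcomp.sub_const (h z)).sub hlin).congr_deriv (by simp)
  have hB : ∀ t : ℝ, HasDerivAt (fun t : ℝ => γ / 2 * ‖w‖ ^ 2 * t ^ 2)
      (γ * ‖w‖ ^ 2 * t) t := by
    intro t
    exact ((hasDerivAt_pow 2 t).const_mul (γ / 2 * ‖w‖ ^ 2)).congr_deriv
      (by push_cast; ring)
  have hbound := image_norm_le_of_norm_deriv_right_le_deriv_boundary
    (a := (0 : ℝ)) (b := 1)
    (fun t _ => (hderiv t).continuousAt.continuousWithinAt)
    (fun t _ => (hderiv t).hasDerivWithinAt)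
    (by simp) hB
    (by
      intro t ht
      rw [← inner_sub_left]
      refine (norm_inner_le_norm _ _).trans ?_
      have := hLip (z + t • w) z
      rw [add_sub_cancel_left, norm_smul, Real.norm_of_nonneg ht.1] at this
      nlinarith [mul_le_mul_of_nonneg_right this (norm_nonneg w)])
    (x := 1) (by simp)
  simpa using hbound

/-- The `ℓ¹`-norm of the constraints after a step along a linearized feasible direction. -/
lemma l1Norm_step_le {m n : ℕ} {c : EuclideanSpace ℝ (Fin n) → EuclideanSpace ℝ (Fin m)}
    {gradc : Fin m → EuclideanSpace ℝ (Fin n) → EuclideanSpace ℝ (Fin n)} {γ : Fin m → ℝ}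
    (hc : ∀ i z, HasGradientAt (fun w => c w i) (gradc i z) z)
    (hcLip : ∀ i z z', ‖gradc i z - gradc i z'‖ ≤ γ i * ‖z - z'‖)
    {z d : EuclideanSpace ℝ (Fin n)}
    (hd : Matrix.toEuclideanLin (Jmat gradc z) d = -(c z)) (a : ℝ) :
    l1Norm (c (z + a • d)) ≤ (1 - a + a ^ 2 / 2) * l1Norm (c z)
      + (∑ i, γ i) / 2 * (a ^ 2 * ‖d‖ ^ 2) := by
  have habs : |1 - a| ≤ 1 - a + a ^ 2 / 2 :=
    abs_le.2 ⟨by nlinarith [sq_nonneg (a - 2)], by nlinarith [sq_nonneg a]⟩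
  have hcomp : ∀ i, |c (z + a • d) i| ≤
      (1 - a + a ^ 2 / 2) * |c z i| + γ i / 2 * (a ^ 2 * ‖d‖ ^ 2) := by
    intro i
    have htaylor := abs_sub_sub_inner_le_of_lipschitz_gradient (hc i) (hcLip i) z (a • d)
    have hJ : ⟪gradc i z, d⟫ = -(c z i) := by
      rw [← toEuclideanLin_Jmat_apply, hd]; rfl
    rw [inner_smul_right, hJ, norm_smul, mul_pow, Real.norm_eq_abs, sq_abs] at htaylor
    have hsplit : c (z + a • d) i = (1 - a) * c z i
        + (c (z + a • d) i - c z i - a * -(c z i)) := by ring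
    calc |c (z + a • d) i| ≤ |(1 - a) * c z i|
          + |c (z + a • d) i - c z i - a * -(c z i)| := by
          conv_lhs => rw [hsplit]
          exact abs_add_le _ _
      _ ≤ _ := by
          rw [abs_mul]
          gcongr
  calc l1Norm (c (z + a • d)) ≤ ∑ i, ((1 - a + a ^ 2 / 2) * |c z i|
        + γ i / 2 * (a ^ 2 * ‖d‖ ^ 2)) := Finset.sum_le_sum fun i _ => hcomp i
    _ = _ := by
      rw [Finset.sum_add_distrib, ← Finset.mul_sum, ← Finset.sum_mul, ← Finset.sum_div, l1Norm]

/-- A minimum-norm solution of a linear system is controlled by the smallest singular value. -/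
lemma norm_le_div_of_mem_range_transpose {m n : ℕ} {A : Matrix (Fin m) (Fin n) ℝ} {s : ℝ}
    (hs : 0 < s) (hsv : ∀ z, s * ‖z‖ ≤ ‖Matrix.toEuclideanLin Aᵀ z‖)
    {v : EuclideanSpace ℝ (Fin n)} (hv : ∃ z, v = Matrix.toEuclideanLin Aᵀ z)
    {r : EuclideanSpace ℝ (Fin m)} (hAv : Matrix.toEuclideanLin A v = r) :
    ‖v‖ ≤ ‖r‖ / s := by
  obtain ⟨z, hz⟩ := hv
  have hinner : ‖v‖ ^ 2 = ⟪r, z⟫ := by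
    rw [← hAv, ← inner_toEuclideanLin_transpose, ← hz, real_inner_self_eq_norm_sq]
  have hcs := real_inner_le_norm r z
  have hsz : s * ‖z‖ ≤ ‖v‖ := hz ▸ hsv z
  rw [le_div_iff₀ hs]
  rcases (norm_nonneg v).eq_or_lt with h0 | hpos
  · rw [← h0]; simp
  · refine le_of_mul_le_mul_right ?_ hpos
    nlinarith [mul_le_mul_of_nonneg_left hsz (norm_nonneg r)]

/-- A one-step logarithmic bound for Adagrad-type accumulators. -/
lemma div_sq_le_log_sub_log {p q r : ℝ} (hp : 0 < p) (hq : 0 < q) (h : q ^ 2 = p ^ 2 + r) :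
    r / q ^ 2 ≤ Real.log (q ^ 2) - Real.log (p ^ 2) := by
  have hlog := Real.log_le_sub_one_of_pos (x := p ^ 2 / q ^ 2) (by positivity)
  rw [Real.log_div (by positivity) (by positivity)] at hlog
  have hr : r / q ^ 2 = 1 - p ^ 2 / q ^ 2 := by
    field_simp; linarith
  linarith

/-- The accumulated quantity divided by the accumulator dominates the increment. -/
lemma sub_le_div_of_sq_eq {p q r : ℝ} (hp : 0 < p) (hq : 0 < q) (hr : 0 ≤ r)
    (h : q ^ 2 = p ^ 2 + r) : q - p ≤ r / q := by
  have hpq : p ≤ q := abs_le_of_sq_le_sq' (by linarith) hq.le |>.2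
  rw [le_div_iff₀ hq]
  nlinarith

/-- Tangent-line bound for the logarithm. -/
lemma log_le_log_add_div_sub_one {t a : ℝ} (ht : 0 < t) (ha : 0 < a) :
    Real.log t ≤ Real.log a + t / a - 1 := by
  have h := Real.log_le_sub_one_of_pos (div_pos ht ha)
  rw [Real.log_div ht.ne' ha.ne'] at h
  linarith

lemma log_one_add_two_mul_le {X : ℝ} (hX : 0 ≤ X) :
    Real.log (1 + 2 * X) ≤ 2 * Real.log (1 + X) := by
  have h : Real.log (1 + 2 * X) ≤ Real.log ((1 + X) ^ 2) :=
    Real.log_le_log (by positivity) (by nlinarith [sq_nonneg X])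
  rwa [Real.log_pow] at h

/-- Positivity of an accumulator with nonnegative increments. -/
lemma prevSeq_pos_and_sq {Ω : Type*} {init : ℝ} (hinit : 0 < init) {b r : ℕ → Ω → ℝ}
    (hr : ∀ k ω, 0 ≤ r k ω)
    (hb : ∀ k ω, b k ω = Real.sqrt ((prevSeq init b k ω) ^ 2 + r k ω)) (k : ℕ) (ω : Ω) :
    0 < prevSeq init b k ω ∧
      (prevSeq init b k ω) ^ 2 = init ^ 2 + ∑ j ∈ Finset.range k, r j ω := by
  induction k with
  | zero => simp [prevSeq, hinit]
  | succ k ih =>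
    have hsum : 0 ≤ ∑ j ∈ Finset.range k, r j ω := Finset.sum_nonneg fun j _ => hr j ω
    have hpos := hr k ω
    rw [Finset.sum_range_succ, ← add_assoc, ← ih.2]
    change 0 < b k ω ∧ (b k ω) ^ 2 = _
    have : 0 < (prevSeq init b k ω) ^ 2 + r k ω := by
      have := ih.1
      positivity
    rw [hb]
    exact ⟨Real.sqrt_pos.2 this, Real.sq_sqrt this.le⟩

/-- Bound on the tangential component of a Newton-type step. -/
lemma sq_norm_tangential_le {m n : ℕ} {A : Matrix (Fin m) (Fin n) ℝ}
    {B : Matrix (Fin n) (Fin n) ℝ} {u v g g' : EuclideanSpace ℝ (Fin n)}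
    {y : EuclideanSpace ℝ (Fin m)} {ζ κH κg ρ κu : ℝ} (hζ : 0 < ζ) (hκH : 0 < κH)
    (hB : ∀ z, ‖Matrix.toEuclideanLin B z‖ ≤ κH * ‖z‖)
    (hBpd : ∀ z, Matrix.toEuclideanLin A z = 0 →
      ζ * ‖z‖ ^ 2 ≤ ⟪z, Matrix.toEuclideanLin B z⟫)
    (hAu : Matrix.toEuclideanLin A u = 0)
    (hsys : Matrix.toEuclideanLin B (u + v) + Matrix.toEuclideanLin Aᵀ y = -g)
    (hg : ‖g'‖ ≤ κg) (hv : ‖v‖ ≤ ρ) (hκu : κu = ζ⁻¹ * κg + ζ⁻¹ * κH * ρ) :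
    ‖u‖ ^ 2 ≤ 2 * (ζ⁻¹ * κH * κu ^ 2 + ζ⁻¹ ^ 2 * ‖g - g'‖ ^ 2) := by
  rcases (norm_nonneg u).eq_or_lt with h0 | hpos
  · rw [← h0, zero_pow two_ne_zero]; positivity
  have hpd := hBpd u hAu
  have hcs := (real_inner_le_norm u _).trans
    (mul_le_mul_of_nonneg_left (hB u) (norm_nonneg u))
  have hζκ : 1 ≤ ζ⁻¹ * κH := by
    rw [inv_mul_eq_div, one_le_div hζ]
    refine le_of_mul_le_mul_right ?_ (pow_pos hpos 2)
    nlinarith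
  have hinner : ⟪u, Matrix.toEuclideanLin B u⟫
      = ⟪u, -(g - g') - g' - Matrix.toEuclideanLin B v⟫ := by
    have hy : ⟪u, Matrix.toEuclideanLin Aᵀ y⟫ = 0 := by
      rw [inner_toEuclideanLin_transpose, hAu, inner_zero_left]
    have h : Matrix.toEuclideanLin B u
        = (-(g - g') - g' - Matrix.toEuclideanLin B v) - Matrix.toEuclideanLin Aᵀ y := by
      rw [map_add] at hsys
      have hg : -(g - g') - g' = -g := by abel
      rw [hg, ← hsys]
      abel
    rw [h, inner_sub_right, hy, sub_zero]
  have hnorm : ‖-(g - g') - g' - Matrix.toEuclideanLin B v‖ ≤ ‖g - g'‖ + κg + κH * ρ := by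
    have h1 := norm_sub_le (-(g - g') - g') (Matrix.toEuclideanLin B v)
    have h2 := norm_sub_le (-(g - g')) g'
    rw [norm_neg] at h2
    have h3 := (hB v).trans (mul_le_mul_of_nonneg_left hv hκH.le)
    linarith
  have hu : ‖u‖ ≤ κu + ζ⁻¹ * ‖g - g'‖ := by
    have h1 : ζ * ‖u‖ ≤ ‖g - g'‖ + κg + κH * ρ := by
      refine le_of_mul_le_mul_right ?_ hpos
      have := (real_inner_le_norm u _).trans (mul_le_mul_of_nonneg_left hnorm hpos.le)
      rw [← hinner] at this
      nlinarith
    have h2 : κu + ζ⁻¹ * ‖g - g'‖ = ζ⁻¹ * (‖g - g'‖ + κg + κH * ρ) := by rw [hκu]; ring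
    rw [h2, inv_mul_eq_div, le_div_iff₀ hζ]
    linarith
  have h1 : ‖u‖ ^ 2 ≤ (κu + ζ⁻¹ * ‖g - g'‖) ^ 2 := by gcongr
  have h2 : κu ^ 2 ≤ ζ⁻¹ * κH * κu ^ 2 := le_mul_of_one_le_left (sq_nonneg _) hζκ
  nlinarith [sq_nonneg (κu - ζ⁻¹ * ‖g - g'‖)]

/-- One-step decrease of the constraint violation in terms of accumulator increments. -/
lemma accumulator_step {m n : ℕ} {c : EuclideanSpace ℝ (Fin n) → EuclideanSpace ℝ (Fin m)}
    {gradc : Fin m → EuclideanSpace ℝ (Fin n) → EuclideanSpace ℝ (Fin n)} {γ : Fin m → ℝ}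
    (hc : ∀ i z, HasGradientAt (fun w => c w i) (gradc i z) z)
    (hcLip : ∀ i z z', ‖gradc i z - gradc i z'‖ ≤ γ i * ‖z - z'‖) (hΓ0 : 0 ≤ ∑ i, γ i)
    {z u v : EuclideanSpace ℝ (Fin n)} {p q q₀ b' b ν θ η κv a : ℝ}
    (hν : 0 < ν) (hθ : 0 ≤ θ) (hq₀ : 0 < q₀) (hp0 : 0 < p) (hq0 : 0 < q) (hb0 : 0 < b')
    (hbk0 : 0 < b) (hκv0 : 0 ≤ κv) (hq2 : q ^ 2 = p ^ 2 + l1Norm (c z))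
    (hb2 : b ^ 2 = b' ^ 2 + ‖u‖ ^ 2) (hqge : q₀ ^ 2 ≤ q ^ 2)
    (hJu : Matrix.toEuclideanLin (Jmat gradc z) u = 0)
    (hJv : Matrix.toEuclideanLin (Jmat gradc z) v = -(c z)) (horth : ⟪u, v⟫ = 0)
    (hvsq : ‖v‖ ^ 2 ≤ κv * l1Norm (c z)) (hα1 : ν / q ≤ a) (hα2 : a ≤ (ν + θ) / q) :
    ν * (q - p) + l1Norm (c (z + a • ((η / b) • u + v)))
      ≤ l1Norm (c z)
        + (ν + θ) ^ 2 * (κv * (∑ i, γ i) + 4) / 2 * (Real.log (q ^ 2) - Real.log (p ^ 2))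
        + η ^ 2 * (ν + θ) ^ 2 * (∑ i, γ i) / (2 * q₀ ^ 2)
          * (Real.log (b ^ 2) - Real.log (b' ^ 2)) := by
  set Γ := ∑ i, γ i
  have hc0 := l1Norm_nonneg (c z)
  set A : ℝ := (ν + θ) ^ 2 * (κv * Γ + 4) / 2 with hA
  set B : ℝ := η ^ 2 * (ν + θ) ^ 2 * Γ / (2 * q₀ ^ 2) with hB
  have hA0 : 0 ≤ A := by rw [hA]; positivity
  have hB0 : 0 ≤ B := by rw [hB]; positivity
  have hincr := sub_le_div_of_sq_eq hp0 hq0 hc0 hq2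
  have hlogq := div_sq_le_log_sub_log hp0 hq0 hq2
  have hlogb := div_sq_le_log_sub_log hb0 hbk0 hb2
  set d := (η / b) • u + v with hd
  have hJd : Matrix.toEuclideanLin (Jmat gradc z) d = -(c z) := by
    rw [hd, map_add, map_smul, hJu, smul_zero, zero_add, hJv]
  have hdsq : ‖d‖ ^ 2 ≤ η ^ 2 * (‖u‖ ^ 2 / b ^ 2)
      + κv * l1Norm (c z) := by
    have h := norm_add_sq_real ((η / b) • u) v
    rw [real_inner_smul_left, horth, norm_smul, mul_pow, Real.norm_eq_abs, sq_abs,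
      div_pow] at h
    calc ‖d‖ ^ 2 = η ^ 2 / b ^ 2 * ‖u‖ ^ 2 + ‖v‖ ^ 2 := by rw [h]; ring
      _ ≤ η ^ 2 / b ^ 2 * ‖u‖ ^ 2 + κv * l1Norm (c z) := by gcongr
      _ = _ := by ring
  have hnext := l1Norm_step_le hc hcLip hJd a
  have hα0 : 0 ≤ a := le_trans (by positivity) hα1
  have hαsq : a ^ 2 ≤ (ν + θ) ^ 2 / q ^ 2 := by
    rw [← div_pow]; gcongr
  have hαsq' : a ^ 2 ≤ (ν + θ) ^ 2 / q₀ ^ 2 := hαsq.trans (by gcongr)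
  have hdecr : ν * (q - p) ≤ a * l1Norm (c z) :=
    calc ν * (q - p) ≤ ν * (l1Norm (c z) / q) := by gcongr
      _ = ν / q * l1Norm (c z) := by ring
      _ ≤ _ := mul_le_mul_of_nonneg_right hα1 hc0
  have hcsq : a ^ 2 * l1Norm (c z) * ((1 + Γ * κv) / 2)
      ≤ A * (Real.log (q ^ 2) - Real.log (p ^ 2)) := by
    calc a ^ 2 * l1Norm (c z) * ((1 + Γ * κv) / 2)
        ≤ (ν + θ) ^ 2 / q ^ 2 * l1Norm (c z) * ((κv * Γ + 4) / 2) := by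
          gcongr ?_ * _ * ?_
          linarith
      _ = A * (l1Norm (c z) / q ^ 2) := by rw [hA]; ring
      _ ≤ _ := by gcongr
  have husq' : a ^ 2 * (Γ / 2 * (η ^ 2 * (‖u‖ ^ 2 / b ^ 2)))
      ≤ B * (Real.log (b ^ 2) - Real.log (b' ^ 2)) :=
    calc a ^ 2 * (Γ / 2 * (η ^ 2 * (‖u‖ ^ 2 / b ^ 2)))
        ≤ (ν + θ) ^ 2 / q₀ ^ 2 * (Γ / 2 * (η ^ 2 * (‖u‖ ^ 2 / b ^ 2))) := by
          gcongr
      _ = B * (‖u‖ ^ 2 / b ^ 2) := by rw [hB]; ring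
      _ ≤ _ := by gcongr
  have hdα : Γ / 2 * (a ^ 2 * ‖d‖ ^ 2) ≤ Γ / 2 * (a ^ 2 *
      (η ^ 2 * (‖u‖ ^ 2 / b ^ 2) + κv * l1Norm (c z))) := by gcongr
  linarith

lemma integral_le_of_condExp_le {Ω : Type*} {m m0 : MeasurableSpace Ω} {μ : Measure Ω}
    [IsProbabilityMeasure μ] (hm : m ≤ m0) {F : Ω → ℝ} {M : ℝ}
    (h : ∀ᵐ ω ∂μ, (μ[F | m]) ω ≤ M) : ∫ ω, F ω ∂μ ≤ M := by
  rw [← integral_condExp hm]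
  simpa using integral_mono_ae integrable_condExp (integrable_const M) h

/-- Bound on the expected final constraint-violation accumulator
for the two-stepsize stochastic SQP method with adaptive stepsizes. -/
theorem stmt16 {m n : ℕ} (hm : 1 ≤ m) (hmn : m ≤ n)
    {Ω : Type*} {m0 : MeasurableSpace Ω} (μ : Measure Ω) [IsProbabilityMeasure μ]
    (ℱ : Filtration ℕ m0)
    -- problem data
    (f : EuclideanSpace ℝ (Fin n) → ℝ)
    (gradf : EuclideanSpace ℝ (Fin n) → EuclideanSpace ℝ (Fin n))
    (c : EuclideanSpace ℝ (Fin n) → EuclideanSpace ℝ (Fin m))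
    (gradc : Fin m → EuclideanSpace ℝ (Fin n) → EuclideanSpace ℝ (Fin n))
    (flow L κg κc s ζ κH M η ν θ σ bm1 qm1 : ℝ) (γ : Fin m → ℝ)
    (hL : 0 < L) (hκg : 0 < κg) (hκc : 0 < κc) (hs : 0 < s) (hζ : 0 < ζ)
    (hκH : 0 < κH) (hM : 0 < M) (hη : 0 < η) (hν : 0 < ν) (hθ : 0 < θ)
    (hbm1 : 0 < bm1) (hqm1 : 0 < qm1)
    (hσ : σ ∈ Set.Ioo (0 : ℝ) 1) (hγ : ∀ i, 0 < γ i)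
    (hf : ∀ z, HasGradientAt f (gradf z) z)
    (hflow : ∀ z, flow ≤ f z)
    (hfLip : ∀ z z', ‖gradf z - gradf z'‖ ≤ L * ‖z - z'‖)
    (hgradb : ∀ z, ‖gradf z‖ ≤ κg)
    (hc : ∀ i z, HasGradientAt (fun w => c w i) (gradc i z) z)
    (hcb : ∀ z, l1Norm (c z) ≤ κc)
    (hcLip : ∀ i z z', ‖gradc i z - gradc i z'‖ ≤ γ i * ‖z - z'‖)
    -- algorithm iterates
    (x0 : EuclideanSpace ℝ (Fin n))
    (x u utrue g v : ℕ → Ω → EuclideanSpace ℝ (Fin n))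
    (y ytrue : ℕ → Ω → EuclideanSpace ℝ (Fin m))
    (H : ℕ → Ω → Matrix (Fin n) (Fin n) ℝ)
    (α : ℕ → Ω → ℝ) (b q : ℕ → Ω → ℝ)
    (hx0 : ∀ ω, x 0 ω = x0)
    (hxmeas : ∀ k, StronglyMeasurable[ℱ k] (x k))
    (hHmeas : ∀ k i j, StronglyMeasurable[ℱ k] (fun ω => H k ω i j))
    (hHnorm : ∀ k ω (z : EuclideanSpace ℝ (Fin n)),
      ‖Matrix.toEuclideanLin (H k ω) z‖ ≤ κH * ‖z‖)
    (hHpd : ∀ k ω (z : EuclideanSpace ℝ (Fin n)),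
      Matrix.toEuclideanLin (Jmat gradc (x k ω)) z = 0 →
      ζ * ‖z‖ ^ 2 ≤ ⟪z, Matrix.toEuclideanLin (H k ω) z⟫)
    (hsv : ∀ k ω (z : EuclideanSpace ℝ (Fin m)),
      s * ‖z‖ ≤ ‖Matrix.toEuclideanLin (Jmat gradc (x k ω))ᵀ z‖)
    (hgmeas : ∀ k, StronglyMeasurable[ℱ (k + 1)] (g k))
    (hgmean : ∀ k, μ[g k | ℱ k] =ᵐ[μ] fun ω => gradf (x k ω))
    (hgvarint : ∀ k, Integrable (fun ω => ‖g k ω - gradf (x k ω)‖ ^ 2) μ)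
    (hgvar : ∀ k, ∀ᵐ ω ∂μ,
      (μ[fun ω' => ‖g k ω' - gradf (x k ω')‖ ^ 2 | ℱ k]) ω ≤ M)
    (humeas : ∀ k, StronglyMeasurable[ℱ (k + 1)] (u k))
    (hymeas : ∀ k, StronglyMeasurable[ℱ (k + 1)] (y k))
    (hvmeas : ∀ k, StronglyMeasurable[ℱ k] (v k))
    (hutmeas : ∀ k, StronglyMeasurable[ℱ k] (utrue k))
    (hytmeas : ∀ k, StronglyMeasurable[ℱ k] (ytrue k))
    (hJu : ∀ k ω, Matrix.toEuclideanLin (Jmat gradc (x k ω)) (u k ω) = 0)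
    (hvrange : ∀ k ω, ∃ z : EuclideanSpace ℝ (Fin m),
      v k ω = Matrix.toEuclideanLin (Jmat gradc (x k ω))ᵀ z)
    (hJp : ∀ k ω, Matrix.toEuclideanLin (Jmat gradc (x k ω)) (u k ω + v k ω)
      = -(c (x k ω)))
    (hsys : ∀ k ω, Matrix.toEuclideanLin (H k ω) (u k ω + v k ω)
      + Matrix.toEuclideanLin (Jmat gradc (x k ω))ᵀ (y k ω) = -(g k ω))
    (hJut : ∀ k ω, Matrix.toEuclideanLin (Jmat gradc (x k ω)) (utrue k ω) = 0)
    (hsyst : ∀ k ω, Matrix.toEuclideanLin (H k ω) (utrue k ω + v k ω)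
      + Matrix.toEuclideanLin (Jmat gradc (x k ω))ᵀ (ytrue k ω) = -(gradf (x k ω)))
    -- adaptive accumulators and stepsizes
    (hb : ∀ k ω, b k ω = Real.sqrt ((prevSeq bm1 b k ω) ^ 2 + ‖u k ω‖ ^ 2))
    (hq : ∀ k ω, q k ω = Real.sqrt ((prevSeq qm1 q k ω) ^ 2 + l1Norm (c (x k ω))))
    (hαmeas : ∀ k, StronglyMeasurable[ℱ (k + 1)] (α k))
    (hα : ∀ k ω, α k ω ∈ Set.Icc (ν / q k ω) (ν / q k ω + min (θ / b k ω) (θ / q k ω)))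
    (hupdate : ∀ k ω, x (k + 1) ω = x k ω + α k ω • ((η / b k ω) • u k ω + v k ω))
    -- constants
    (κv κu κβ τmin Γ κ₃ κ₄ κ₅ κ₆ : ℝ)
    (hκv : κv = max (1 / s) (κc / s ^ 2))
    (hκu : κu = ζ⁻¹ * κg + ζ⁻¹ * κH * κv * κc)
    (hκβ : κβ = η / bm1)
    (hΓ : Γ = ∑ i, γ i)
    (hτmin : τmin = (1 - σ) / (κv * (κβ * κH * κu + κg)))
    (hκ₃ : κ₃ = ζ⁻¹ * (κH * κu ^ 2 + ζ⁻¹ * M))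
    (hκ₄ : κ₄ = max (ζ⁻¹ * κH ^ 2) (κβ * (1 + 2 * κu) * κH ^ 2 * κv * τmin / σ))
    (hκ₅ : κ₅ = (ν + θ) ^ 2 * (κv * (τmin * L + Γ) + 4) / 2)
    (hκ₆ : κ₆ = η ^ 2 * (ν + θ) ^ 2 * (τmin * L + Γ) / (2 * qm1 ^ 2)
      + 3 * η ^ 2 * κ₃ * κ₄ * (ν + θ) ^ 2 / (2 * ν * qm1 * bm1)
      + 3 * κ₄ * θ ^ 2 * (η ^ 2 + κβ ^ 2 * κ₃) / (2 * η * ν)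
      + 3 * ζ⁻¹ * M * κ₄ * θ ^ 2 * κβ / (2 * ν * qm1 * bm1 ^ 2))
    (K : ℕ) (hK : 1 ≤ K) :
    ∫ ω, q (K - 1) ω ∂μ
      ≤ qm1 + 2 / (ν * σ) *
        (τmin * (f x0 - flow) + l1Norm (c x0)
          + κ₅ * Real.log (1 + κc * K / qm1 ^ 2)
          + κ₆ * Real.log (1 + ζ⁻¹ * (κH * κu ^ 2 + ζ⁻¹ * M) * K / bm1 ^ 2)) := by
  have hΓ0 : 0 ≤ Γ := hΓ ▸ Finset.sum_nonneg fun i _ => (hγ i).le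
  have hκv1 : 1 / s ≤ κv := hκv ▸ le_max_left _ _
  have hκv2 : κc / s ^ 2 ≤ κv := hκv ▸ le_max_right _ _
  have hκv0 : 0 < κv := (by positivity : 0 < 1 / s).trans_le hκv1
  have hκu0 : 0 < κu := by rw [hκu]; positivity
  have hκβ0 : 0 < κβ := by rw [hκβ]; positivity
  have hτ0 : 0 < τmin := by
    have := sub_pos.2 hσ.2
    rw [hτmin]; positivity
  have hκ₃0 : 0 < κ₃ := by rw [hκ₃]; positivity
  have hκ₄0 : 0 < κ₄ := by
    rw [hκ₄]; exact lt_max_of_lt_left (by positivity)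
  have hl1 : ∀ k ω, 0 ≤ l1Norm (c (x k ω)) := fun k ω => l1Norm_nonneg _
  have hqs := prevSeq_pos_and_sq hqm1 hl1 hq
  have hbs := prevSeq_pos_and_sq hbm1 (fun k ω => sq_nonneg ‖u k ω‖) hb
  have hvnorm : ∀ k ω, ‖v k ω‖ ≤ l1Norm (c (x k ω)) / s := by
    intro k ω
    have hJv : Matrix.toEuclideanLin (Jmat gradc (x k ω)) (v k ω) = -(c (x k ω)) := by
      have h := hJp k ω
      rwa [map_add, hJu, zero_add] at h
    have h := norm_le_div_of_mem_range_transpose hs (hsv k ω) (hvrange k ω) hJv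
    rw [norm_neg] at h
    exact h.trans (by gcongr; exact norm_le_l1Norm _)
  have hvsq : ∀ k ω, ‖v k ω‖ ^ 2 ≤ κv * l1Norm (c (x k ω)) := by
    intro k ω
    calc ‖v k ω‖ ^ 2 ≤ (l1Norm (c (x k ω)) / s) ^ 2 := by gcongr; exact hvnorm k ω
      _ = l1Norm (c (x k ω)) / s ^ 2 * l1Norm (c (x k ω)) := by ring
      _ ≤ κv * l1Norm (c (x k ω)) := by
        refine mul_le_mul_of_nonneg_right (le_trans ?_ hκv2) (hl1 k ω)
        gcongr
        exact hcb _
  have hvκ : ∀ k ω, ‖v k ω‖ ≤ κv * κc := by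
    intro k ω
    calc ‖v k ω‖ ≤ 1 / s * l1Norm (c (x k ω)) := by
          rw [one_div_mul_eq_div]; exact hvnorm k ω
      _ ≤ κv * κc := mul_le_mul hκv1 (hcb _) (hl1 k ω) hκv0.le
  have husq : ∀ k ω, ‖u k ω‖ ^ 2 ≤
      2 * (ζ⁻¹ * κH * κu ^ 2 + ζ⁻¹ ^ 2 * ‖g k ω - gradf (x k ω)‖ ^ 2) := fun k ω =>
    sq_norm_tangential_le hζ hκH (hHnorm k ω) (hHpd k ω) (hJu k ω) (hsys k ω)
      (hgradb (x k ω)) (hvκ k ω) (by rw [hκu]; ring)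
  set A : ℝ := (ν + θ) ^ 2 * (κv * Γ + 4) / 2 with hA
  set B : ℝ := η ^ 2 * (ν + θ) ^ 2 * Γ / (2 * qm1 ^ 2) with hB
  have hA0 : 0 ≤ A := by rw [hA]; positivity
  have hB0 : 0 ≤ B := by rw [hB]; positivity
  have hstep : ∀ k ω, ν * (q k ω - prevSeq qm1 q k ω) + l1Norm (c (x (k + 1) ω))
      ≤ l1Norm (c (x k ω))
        + A * (Real.log (q k ω ^ 2) - Real.log (prevSeq qm1 q k ω ^ 2))
        + B * (Real.log (b k ω ^ 2) - Real.log (prevSeq bm1 b k ω ^ 2)) := by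
    intro k ω
    obtain ⟨hp0, -⟩ := hqs k ω
    obtain ⟨hb0, -⟩ := hbs k ω
    obtain ⟨hq0, hqsum⟩ : 0 < q k ω ∧ q k ω ^ 2 = _ := hqs (k + 1) ω
    obtain ⟨hbk0, -⟩ : 0 < b k ω ∧ b k ω ^ 2 = _ := hbs (k + 1) ω
    have hq2 : q k ω ^ 2 = prevSeq qm1 q k ω ^ 2 + l1Norm (c (x k ω)) := by
      rw [hq k ω, Real.sq_sqrt (add_nonneg (sq_nonneg _) (hl1 k ω))]
    have hb2 : b k ω ^ 2 = prevSeq bm1 b k ω ^ 2 + ‖u k ω‖ ^ 2 := by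
      rw [hb k ω, Real.sq_sqrt (by positivity)]
    have hqge : qm1 ^ 2 ≤ q k ω ^ 2 := by
      rw [hqsum]
      exact le_add_of_nonneg_right (Finset.sum_nonneg fun j _ => hl1 j ω)
    obtain ⟨z, hz⟩ := hvrange k ω
    have hJv : Matrix.toEuclideanLin (Jmat gradc (x k ω)) (v k ω) = -(c (x k ω)) := by
      have h := hJp k ω
      rwa [map_add, hJu, zero_add] at h
    have horth : ⟪u k ω, v k ω⟫ = 0 := by
      rw [hz, inner_toEuclideanLin_transpose, hJu, inner_zero_left]
    have hmin := min_le_right (θ / b k ω) (θ / q k ω)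
    rw [hA, hB, hupdate, hΓ]
    exact accumulator_step hc hcLip (hΓ ▸ hΓ0) hν hθ.le hqm1 hp0 hq0 hb0 hbk0 hκv0.le hq2
      hb2 hqge (hJu k ω) hJv horth (hvsq k ω) (hα k ω).1
      ((hα k ω).2.trans (by rw [add_div]; gcongr))
  have hsum : ∀ N ω, ν * (prevSeq qm1 q N ω - qm1) + l1Norm (c (x N ω))
      ≤ l1Norm (c x0)
        + A * (Real.log (prevSeq qm1 q N ω ^ 2) - Real.log (qm1 ^ 2))
        + B * (Real.log (prevSeq bm1 b N ω ^ 2) - Real.log (bm1 ^ 2)) := by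
    intro N ω
    induction N with
    | zero => simp [prevSeq, hx0]
    | succ N ih =>
      have h := hstep N ω
      simp only [prevSeq]
      linarith
  set X : ℝ := ζ⁻¹ * (κH * κu ^ 2 + ζ⁻¹ * M) * K / bm1 ^ 2 with hX
  have hX0 : 0 ≤ X := by rw [hX]; positivity
  set lq : ℝ := Real.log (1 + κc * K / qm1 ^ 2) with hlq
  have hlq0 : 0 ≤ lq := Real.log_nonneg (le_add_of_nonneg_right (by positivity))
  have hlogq : ∀ ω, Real.log (prevSeq qm1 q K ω ^ 2) - Real.log (qm1 ^ 2) ≤ lq := by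
    intro ω
    have hpos := (hqs K ω).1
    rw [← Real.log_div (by positivity) (by positivity)]
    refine Real.log_le_log (by positivity) ?_
    rw [(hqs K ω).2, add_div, div_self (by positivity)]
    gcongr
    refine (Finset.sum_le_sum fun j _ => hcb (x j ω)).trans_eq ?_
    simp [mul_comm]
  set D : ℕ → Ω → ℝ := fun k ω => ‖g k ω - gradf (x k ω)‖ ^ 2 with hD
  set Y : Ω → ℝ := fun ω =>
    2 * (ζ⁻¹ * κH * κu ^ 2 * K + ζ⁻¹ ^ 2 * ∑ k ∈ Finset.range K, D k ω) / bm1 ^ 2 with hY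
  have hYint : Integrable Y μ :=
    (((integrable_const _).add ((integrable_finsetSum _ fun k _ => hgvarint k).const_mul
      _)).const_mul _).div_const _
  have hYmean : ∫ ω, Y ω ∂μ ≤ 2 * X := by
    have hDsum : ∫ ω, ∑ k ∈ Finset.range K, D k ω ∂μ ≤ K * M := by
      rw [integral_finsetSum _ fun k _ => hgvarint k]
      refine (Finset.sum_le_sum fun k _ =>
        integral_le_of_condExp_le (ℱ.le k) (hgvar k)).trans_eq ?_
      simp
    have hint : ∫ ω, Y ω ∂μ = 2 * (ζ⁻¹ * κH * κu ^ 2 * K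
        + ζ⁻¹ ^ 2 * ∫ ω, ∑ k ∈ Finset.range K, D k ω ∂μ) / bm1 ^ 2 := by
      rw [hY, integral_div, integral_const_mul, integral_add (integrable_const _)
        ((integrable_finsetSum _ fun k _ => hgvarint k).const_mul _), integral_const_mul (ζ⁻¹ ^ 2),
        integral_const, probReal_univ, one_smul]
    calc ∫ ω, Y ω ∂μ ≤ 2 * (ζ⁻¹ * κH * κu ^ 2 * K + ζ⁻¹ ^ 2 * (K * M)) / bm1 ^ 2 := by
          rw [hint]; gcongr
      _ = 2 * X := by rw [hX]; ring
  have hlogb : ∀ ω, Real.log (prevSeq bm1 b K ω ^ 2) - Real.log (bm1 ^ 2)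
      ≤ Real.log (1 + 2 * X) + (1 + Y ω) / (1 + 2 * X) - 1 := by
    intro ω
    have hpos := (hbs K ω).1
    have hratio : prevSeq bm1 b K ω ^ 2 / bm1 ^ 2 ≤ 1 + Y ω := by
      rw [(hbs K ω).2, add_div, div_self (by positivity), hY]
      refine add_le_add_right (div_le_div_of_nonneg_right ?_ (by positivity)) _
      refine (Finset.sum_le_sum fun j _ => husq j ω).trans_eq ?_
      rw [← Finset.mul_sum, Finset.sum_add_distrib, Finset.sum_const, Finset.card_range,
        nsmul_eq_mul, ← Finset.mul_sum, mul_comm (K : ℝ)]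
    rw [← Real.log_div (by positivity) (by positivity)]
    refine (log_le_log_add_div_sub_one (a := 1 + 2 * X) (by positivity)
      (by positivity)).trans ?_
    gcongr
  obtain ⟨N, rfl⟩ : ∃ N, K = N + 1 := ⟨K - 1, by lia⟩
  rw [Nat.add_sub_cancel]
  have hqbound : ∀ ω, q N ω ≤ qm1 + ν⁻¹ * (l1Norm (c x0) + A * lq
      + B * (Real.log (1 + 2 * X) + (1 + Y ω) / (1 + 2 * X) - 1)) := by
    intro ω
    have h : ν * (q N ω - qm1) + _ ≤ _ := hsum (N + 1) ω
    have h1 := mul_le_mul_of_nonneg_left (hlogq ω) hA0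
    have h2 := mul_le_mul_of_nonneg_left (hlogb ω) hB0
    have h3 := hl1 (N + 1) ω
    rw [← sub_le_iff_le_add', inv_mul_eq_div, le_div_iff₀ hν]
    linarith
  have hlogint : Integrable (fun ω => (1 + Y ω) / (1 + 2 * X)) μ :=
    ((integrable_const _).add hYint).div_const _
  have hlogmean : ∫ ω, (1 + Y ω) / (1 + 2 * X) ∂μ ≤ 1 := by
    rw [integral_div, integral_add (integrable_const _) hYint, div_le_one (by positivity)]
    simpa using hYmean
  have hAκ : A ≤ κ₅ := by
    rw [hA, hκ₅]; gcongr; exact le_add_of_nonneg_left (by positivity)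
  have hBκ : B ≤ κ₆ := by
    rw [hκ₆, add_assoc, add_assoc]
    refine le_add_of_le_of_nonneg ?_ (by positivity)
    rw [hB]; gcongr; exact le_add_of_nonneg_left (by positivity)
  have hlX0 : 0 ≤ Real.log (1 + X) := Real.log_nonneg (by linarith)
  have hc0 : 0 ≤ l1Norm (c x0) := l1Norm_nonneg _
  have hf0 : 0 ≤ τmin * (f x0 - flow) := mul_nonneg hτ0.le (sub_nonneg.2 (hflow x0))
  have hκ₅0 := hA0.trans hAκ
  have hκ₆0 := hB0.trans hBκ
  calc ∫ ω, q N ω ∂μ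
      ≤ ∫ ω, (qm1 + ν⁻¹ * (l1Norm (c x0) + A * lq
          + B * (Real.log (1 + 2 * X) + (1 + Y ω) / (1 + 2 * X) - 1))) ∂μ :=
        integral_mono_of_nonneg (ae_of_all _ fun ω => (hqs (N + 1) ω).1.le)
          ((integrable_const _).add (((integrable_const _).add
            ((((integrable_const _).add hlogint).sub (integrable_const _)).const_mul
              _)).const_mul _)) (ae_of_all _ hqbound)
    _ = qm1 + ν⁻¹ * (l1Norm (c x0) + A * lq
          + B * (Real.log (1 + 2 * X) + ∫ ω, (1 + Y ω) / (1 + 2 * X) ∂μ - 1)) := by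
        have h : ∀ ω, qm1 + ν⁻¹ * (l1Norm (c x0) + A * lq
            + B * (Real.log (1 + 2 * X) + (1 + Y ω) / (1 + 2 * X) - 1))
            = (qm1 + ν⁻¹ * (l1Norm (c x0) + A * lq + B * (Real.log (1 + 2 * X) - 1)))
              + ν⁻¹ * B * ((1 + Y ω) / (1 + 2 * X)) := fun ω => by ring
        simp_rw [h]
        rw [integral_add (integrable_const _) (hlogint.const_mul _), integral_const_mul,
          integral_const, probReal_univ, one_smul]
        ring
    _ ≤ qm1 + ν⁻¹ * (l1Norm (c x0) + A * lq + B * (2 * Real.log (1 + X))) := by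
        gcongr
        linarith [log_one_add_two_mul_le hX0]
    _ ≤ qm1 + ν⁻¹ * (2 * (τmin * (f x0 - flow) + l1Norm (c x0) + κ₅ * lq
          + κ₆ * Real.log (1 + X))) := by
        have h1 := mul_le_mul_of_nonneg_right hAκ hlq0
        have h2 := mul_le_mul_of_nonneg_right hBκ hlX0
        have h3 := mul_nonneg hκ₅0 hlq0
        gcongr
        linarith
    _ ≤ qm1 + 2 / (ν * σ) * (τmin * (f x0 - flow) + l1Norm (c x0) + κ₅ * lq
          + κ₆ * Real.log (1 + X)) := by
        rw [← mul_assoc]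
        gcongr
        rw [inv_mul_eq_div]
        have := hσ.1
        gcongr
        exact mul_le_of_le_one_right hν.le hσ.2.le
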